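/- Let b : [0,T]×ℝ^d×P(ℝ^d) → ℝ^d and a : [0,T]×ℝ^d×P(ℝ^d) → Sym₊(ℝ^{d×d}) be Borel. The set MP(b,a) of probability measures λ on C([0,T],ℝ^d) that are martingale solutions for L^λ_{b_t,a_t} and satisfy ∫∫_0^T [|b_t(γ_t,(e_t)_#λ)|/(1+|γ_t|) + |a_t(γ_t,(e_t)_#λ)|/(1+|γ_t|²)] dt dλ < ∞, is a Borel subset of P(C([0,T],ℝ^d)) with the narrow topology. -/

import Mathlib

open MeasureTheory Set
open scoped ENNReal RealInnerProductSpace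

noncomputable section

abbrev Ed (d : ℕ) := EuclideanSpace ℝ (Fin d)

abbrev PathSp (T : ℝ) (d : ℕ) := C(Set.Icc (0:ℝ) T, Ed d)

instance (T : ℝ) (d : ℕ) : MeasurableSpace (PathSp T d) := borel _

/-- Evaluation `e_t : C([0,T],ℝ^d) → ℝ^d` (with time clamped to `[0,T]`). -/
def evalAt {T : ℝ} {d : ℕ} (hT : 0 ≤ T) (t : ℝ) (γ : PathSp T d) : Ed d :=
  γ (Set.projIcc 0 T hT t)

/-- The natural filtration `F_t = σ(e_r : r ≤ t)` on `C([0,T],ℝ^d)`. -/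
def natFilt (T : ℝ) (d : ℕ) (t : ℝ) : MeasurableSpace (PathSp T d) :=
  ⨆ s : {s : Set.Icc (0:ℝ) T // (s : ℝ) ≤ t},
    MeasurableSpace.comap (fun γ : PathSp T d => γ s.1) (borel (Ed d))

/-- Martingale condition in the tested sense. -/
def MartCond {T : ℝ} {d : ℕ} (lam : Measure (PathSp T d)) (X : ℝ → PathSp T d → ℝ) :
    Prop :=
  ∀ s t : ℝ, 0 ≤ s → s ≤ t → t ≤ T →
    ∀ H : PathSp T d → ℝ, Measurable[natFilt T d s] H →
      (∀ γ, H γ ∈ Set.Icc (0:ℝ) 1) →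
      ∫ γ, H γ * (X t γ - X s γ) ∂lam = 0

/-- The non-local operator `L^μ_{b_t,a_t}φ(x) = b_t(x,μ)·∇φ(x) + (1/2)a_t(x,μ):∇²φ(x)`. -/
def Lop {d : ℕ} (b : ℝ → Ed d → Measure (Ed d) → Ed d)
    (a : ℝ → Ed d → Measure (Ed d) → (Ed d →L[ℝ] Ed d))
    (μ : Measure (Ed d)) (t : ℝ) (φ : Ed d → ℝ) (x : Ed d) : ℝ :=
  ⟪b t x μ, gradient φ x⟫ +
    (1/2) * LinearMap.trace ℝ (Ed d) ((a t x μ ∘L fderiv ℝ (gradient φ) x).toLinearMap)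

/-- `ξ ∈ C_c^1((0,T))`. -/
def IsTestXi (T : ℝ) (ξ : ℝ → ℝ) : Prop :=
  ContDiff ℝ 1 ξ ∧ HasCompactSupport ξ ∧ Function.support ξ ⊆ Set.Ioo 0 T

/-- `φ ∈ C_c^2(ℝ^d)`. -/
def IsTestPhi {d : ℕ} (φ : Ed d → ℝ) : Prop :=
  ContDiff ℝ 2 φ ∧ HasCompactSupport φ

/-- The process `X_t^{ξφ,λ}(γ) = ξ(t)φ(γ_t) − ∫_0^t [ξ'(r)φ(γ_r) + ξ(r)L^λ_{b_r,a_r}φ(γ_r)] dr`. -/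
def Xproc {d : ℕ} {T : ℝ} (hT : 0 ≤ T) (b : ℝ → Ed d → Measure (Ed d) → Ed d)
    (a : ℝ → Ed d → Measure (Ed d) → (Ed d →L[ℝ] Ed d))
    (lam : Measure (PathSp T d)) (ξ : ℝ → ℝ) (φ : Ed d → ℝ)
    (t : ℝ) (γ : PathSp T d) : ℝ :=
  ξ t * φ (evalAt hT t γ) -
    ∫ r in (0:ℝ)..t,
      (deriv ξ r * φ (evalAt hT r γ) +
        ξ r * Lop b a (lam.map (evalAt hT r)) r φ (evalAt hT r γ))

/-- `λ ∈ MP(b,a)`: a probability measure on path space, with the weighted integrability,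
solving the martingale problem for `L^λ_{b_t,a_t}`. -/
def MPmem {d : ℕ} {T : ℝ} (hT : 0 ≤ T) (b : ℝ → Ed d → Measure (Ed d) → Ed d)
    (a : ℝ → Ed d → Measure (Ed d) → (Ed d →L[ℝ] Ed d))
    (lam : Measure (PathSp T d)) : Prop :=
  IsProbabilityMeasure lam ∧
  (∫⁻ γ, ∫⁻ t in Set.Icc (0:ℝ) T,
      ENNReal.ofReal
        (‖b t (evalAt hT t γ) (lam.map (evalAt hT t))‖ / (1 + ‖evalAt hT t γ‖) +
         ‖a t (evalAt hT t γ) (lam.map (evalAt hT t))‖ / (1 + ‖evalAt hT t γ‖ ^ 2))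
      ∂volume ∂lam) < ∞ ∧
  ∀ ξ φ, IsTestXi T ξ → IsTestPhi φ → MartCond lam (Xproc hT b a lam ξ φ)


instance (T : ℝ) (d : ℕ) : BorelSpace (PathSp T d) := ⟨rfl⟩

open Filter Topology Function

theorem MeasureTheory.ProbabilityMeasure.measurableSpace_le_borel {Ω : Type*} [TopologicalSpace Ω]
    [MeasurableSpace Ω] [BorelSpace Ω] [HasOuterApproxClosed Ω] :
    (inferInstance : MeasurableSpace (ProbabilityMeasure Ω)) ≤ borel (ProbabilityMeasure Ω) := by
  refine MeasurableSpace.comap_le_iff_le_map.2 ?_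
  let _ : MeasurableSpace (ProbabilityMeasure Ω) := borel _
  have : BorelSpace (ProbabilityMeasure Ω) := ⟨rfl⟩
  have key : Measurable fun μ : ProbabilityMeasure Ω => (μ : Measure Ω) := by
    refine Measurable.measure_of_isPiSystem_of_isProbabilityMeasure
      (BorelSpace.measurable_eq.trans borel_eq_generateFrom_isClosed) isPiSystem_isClosed ?_
    intro F (hF : IsClosed F)
    refine measurable_of_tendsto_metrizable
      (f := fun n (μ : ProbabilityMeasure Ω) => ∫⁻ x, hF.apprSeq n x ∂(μ : Measure Ω)) ?_ ?_
    · intro n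
      exact (ProbabilityMeasure.continuous_lintegral_boundedContinuousFunction _).measurable
    · rw [tendsto_pi_nhds]
      intro μ
      exact HasOuterApproxClosed.tendsto_lintegral_apprSeq hF (μ : Measure Ω)
  exact key.le_map

theorem MeasurableSpace.exists_countable_isSetAlgebra_generateFrom_eq {α : Type*}
    (m : MeasurableSpace α) [m.CountablyGenerated] :
    ∃ C : Set (Set α), C.Countable ∧ IsSetAlgebra C ∧ m = generateFrom C :=
  ⟨generateSetAlgebra (countableGeneratingSet α),
    countable_generateSetAlgebra (countable_countableGeneratingSet (α := α)),
    isSetAlgebra_generateSetAlgebra, by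
      rw [generateFrom_generateSetAlgebra_eq, generateFrom_countableGeneratingSet]⟩

/-- Orthogonality to indicators of a generating algebra extends to bounded measurable factors. -/
theorem MeasureTheory.integral_mul_eq_zero_of_isSetAlgebra {Ω : Type*} {m m0 : MeasurableSpace Ω}
    {μ : Measure Ω} [IsFiniteMeasure μ] (hm : m ≤ m0) {C : Set (Set Ω)} (hC : IsSetAlgebra C)
    (hgen : m = MeasurableSpace.generateFrom C) {Y H : Ω → ℝ} (hY : Integrable Y μ)
    (hzero : ∀ A ∈ C, ∫ ω in A, Y ω ∂μ = 0) (hH : Measurable[m] H)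
    (hH01 : ∀ ω, H ω ∈ Icc (0 : ℝ) 1) : ∫ ω, H ω * Y ω ∂μ = 0 := by
  have hpi : IsPiSystem C := fun s hs t ht _ => hC.inter_mem hs ht
  have htot : ∫ ω, Y ω ∂μ = 0 := by simpa using hzero univ hC.univ_mem
  have hset : ∀ A, MeasurableSet[m] A → ∫ ω in A, Y ω ∂μ = 0 := by
    refine MeasurableSpace.induction_on_inter (C := fun A _ => ∫ ω in A, Y ω ∂μ = 0) hgen hpi
      (by simp) hzero ?_ ?_
    · intro A hA h
      have := integral_add_compl (hm A hA) hY
      linarith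
    · intro f hd hf h
      rw [integral_iUnion (fun i => hm _ (hf i)) hd hY.integrableOn]
      simp [h]
  have hcond : 0 =ᵐ[μ] μ[Y | m] := by
    refine ae_eq_condExp_of_forall_setIntegral_eq hm hY (fun _ _ _ => integrableOn_zero) ?_
      aestronglyMeasurable_zero
    intro A hA _
    simp [hset A hA]
  have hHY : Integrable (H * Y) μ := by
    refine hY.bdd_mul (c := 1) (hH.mono hm le_rfl).aestronglyMeasurable (ae_of_all _ fun ω => ?_)
    rw [Real.norm_of_nonneg (hH01 ω).1]
    exact (hH01 ω).2
  have h1 := condExp_mul_of_stronglyMeasurable_left (m := m) hH.stronglyMeasurable hHY hY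
  have h2 : μ[H * Y | m] =ᵐ[μ] 0 := by
    filter_upwards [h1, hcond] with ω h3 h4
    rw [h3, Pi.mul_apply, ← h4]; simp
  calc ∫ ω, H ω * Y ω ∂μ = ∫ ω, (μ[H * Y | m]) ω ∂μ := (integral_condExp hm).symm
    _ = 0 := by rw [integral_congr_ae h2]; simp

theorem natFilt_le (T : ℝ) (d : ℕ) (t : ℝ) :
    natFilt T d t ≤ (inferInstance : MeasurableSpace (PathSp T d)) := by
  refine iSup_le fun s => ?_
  rw [← BorelSpace.measurable_eq (α := Ed d)]
  exact (ContinuousEvalConst.continuous_eval_const s.1).measurable.comap_le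

theorem natFilt_mono (T : ℝ) (d : ℕ) {s t : ℝ} (h : s ≤ t) : natFilt T d s ≤ natFilt T d t := by
  refine iSup_le fun r => ?_
  exact le_iSup (fun r : {r : Set.Icc (0:ℝ) T // (r : ℝ) ≤ t} =>
    MeasurableSpace.comap (fun γ : PathSp T d => γ r.1) (borel (Ed d))) ⟨r.1, r.2.trans h⟩

theorem countablyGenerated_natFilt {T : ℝ} (hT : 0 ≤ T) (d : ℕ) {t : ℝ} (ht : 0 ≤ t) :
    (natFilt T d t).CountablyGenerated := by
  let I := {s : Set.Icc (0:ℝ) T // (s : ℝ) ≤ t}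
  have : Nonempty I := ⟨⟨⟨0, le_rfl, hT⟩, ht⟩⟩
  let D : ℕ → I := TopologicalSpace.denseSeq I
  have hD : DenseRange D := TopologicalSpace.denseRange_denseSeq I
  let R : PathSp T d → ℕ → Ed d := fun γ n => γ (D n).1
  suffices h : natFilt T d t = MeasurableSpace.comap R inferInstance by
    rw [h]; exact MeasurableSpace.CountablyGenerated.comap R
  apply le_antisymm
  · refine iSup_le fun s => ?_
    rw [← BorelSpace.measurable_eq (α := Ed d)]
    obtain ⟨u, hu, hlim⟩ := mem_closure_iff_seq_limit.1 (hD.closure_range ▸ mem_univ s :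
      s ∈ closure (range D))
    choose n hn using hu
    refine Measurable.comap_le ?_
    let : MeasurableSpace (PathSp T d) := MeasurableSpace.comap R inferInstance
    refine measurable_of_tendsto_metrizable (f := fun k (γ : PathSp T d) => γ (D (n k)).1) ?_ ?_
    · intro k
      exact (measurable_pi_apply (n k)).comp (comap_measurable R)
    · rw [tendsto_pi_nhds]
      intro γ
      simp only [hn]
      exact ((γ.continuous.comp continuous_subtype_val).tendsto s).comp hlim
  · refine Measurable.comap_le ?_
    let : MeasurableSpace (PathSp T d) := natFilt T d t
    refine measurable_pi_iff.2 fun n => ?_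
    refine Measurable.of_comap_le ?_
    rw [BorelSpace.measurable_eq (α := Ed d)]
    exact le_iSup (fun r : I =>
      MeasurableSpace.comap (fun γ : PathSp T d => γ r.1) (borel (Ed d))) (D n)

theorem exists_countable_seq_tendsto {ι Z : Type*} [TopologicalSpace Z]
    [SecondCountableTopology Z] (J : ι → Z) :
    ∃ D : Set ι, D.Countable ∧ ∀ i, ∃ u : ℕ → ι, (∀ n, u n ∈ D) ∧
      Tendsto (fun n => J (u n)) atTop (𝓝 (J i)) := by
  let : TopologicalSpace ι := TopologicalSpace.induced J inferInstance
  have hJ : IsInducing J := ⟨rfl⟩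
  have : SecondCountableTopology ι := hJ.secondCountableTopology
  obtain ⟨D, hDc, hD⟩ := TopologicalSpace.exists_countable_dense ι
  refine ⟨D, hDc, fun i => ?_⟩
  obtain ⟨u, hu, hlim⟩ := mem_closure_iff_seq_limit.1 (hD i)
  exact ⟨u, hu, (hJ.continuous.tendsto i).comp hlim⟩

theorem MeasurableSet.measurable_indicator_one {Ω : Type*} {m : MeasurableSpace Ω} {A : Set Ω}
    (hA : MeasurableSet A) : Measurable (A.indicator fun _ => (1 : ℝ)) :=
  measurable_const.indicator hA

section Measurability

variable {d : ℕ} {T : ℝ} (hT : 0 ≤ T) (b : ℝ → Ed d → Measure (Ed d) → Ed d)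
  (a : ℝ → Ed d → Measure (Ed d) → (Ed d →L[ℝ] Ed d))

/-- The weighted size of the coefficients along a path. -/
def coeffWeight (lam : Measure (PathSp T d)) (γ : PathSp T d) (t : ℝ) : ℝ :=
  ‖b t (evalAt hT t γ) (lam.map (evalAt hT t))‖ / (1 + ‖evalAt hT t γ‖) +
    ‖a t (evalAt hT t γ) (lam.map (evalAt hT t))‖ / (1 + ‖evalAt hT t γ‖ ^ 2)

/-- The integrand of the drift part of `Xproc`. -/
def driftIntegrand (lam : Measure (PathSp T d)) (ξ : ℝ → ℝ) (φ : Ed d → ℝ) (γ : PathSp T d)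
    (r : ℝ) : ℝ :=
  deriv ξ r * φ (evalAt hT r γ) +
    ξ r * Lop b a (lam.map (evalAt hT r)) r φ (evalAt hT r γ)

/-- The trace of endomorphisms, as a continuous linear functional. -/
def traceCLM (d : ℕ) : (Ed d →L[ℝ] Ed d) →L[ℝ] ℝ :=
  LinearMap.toContinuousLinearMap
    ((LinearMap.trace ℝ (Ed d)) ∘ₗ (ContinuousLinearMap.coeLM ℝ))

theorem traceCLM_apply (A : Ed d →L[ℝ] Ed d) :
    traceCLM d A = LinearMap.trace ℝ (Ed d) A.toLinearMap := rfl

theorem IsTestPhi.contDiff_gradient {φ : Ed d → ℝ} (hφ : IsTestPhi φ) :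
    ContDiff ℝ 1 (gradient φ) :=
  (InnerProductSpace.toDual ℝ (Ed d)).symm.contDiff.comp
    (hφ.1.fderiv_right (m := 1) (by norm_num))

theorem IsTestPhi.continuous_fderiv_gradient {φ : Ed d → ℝ} (hφ : IsTestPhi φ) :
    Continuous (fderiv ℝ (gradient φ)) :=
  hφ.contDiff_gradient.continuous_fderiv one_ne_zero

theorem continuous_evalAt_uncurry :
    Continuous fun p : ℝ × PathSp T d => evalAt hT p.1 p.2 :=
  continuous_eval.comp
    (continuous_snd.prodMk ((continuous_projIcc (h := hT)).comp continuous_fst))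

theorem measurable_evalAt (t : ℝ) : Measurable (evalAt (d := d) hT t) :=
  ((continuous_evalAt_uncurry hT).comp (Continuous.prodMk_right t)).measurable

theorem continuous_evalAt_left (γ : PathSp T d) : Continuous fun t => evalAt hT t γ :=
  (continuous_evalAt_uncurry hT).comp (Continuous.prodMk_left γ)

/-- The kernel sending a probability measure to itself. -/
def coeKernel (Ω : Type*) [MeasurableSpace Ω] : ProbabilityTheory.Kernel (ProbabilityMeasure Ω) Ω :=
  ⟨fun μ => μ, measurable_subtype_coe⟩

instance (Ω : Type*) [MeasurableSpace Ω] :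
    ProbabilityTheory.IsMarkovKernel (coeKernel Ω) :=
  ⟨fun μ => inferInstanceAs (IsProbabilityMeasure (μ : Measure Ω))⟩

theorem measurable_map_evalAt :
    Measurable fun p : ℝ × ProbabilityMeasure (PathSp T d) =>
      (p.2 : Measure (PathSp T d)).map (evalAt hT p.1) := by
  refine Measure.measurable_of_measurable_coe _ fun s hs => ?_
  simp only [Measure.map_apply (measurable_evalAt hT _) hs]
  have hset : MeasurableSet
      {q : (ℝ × ProbabilityMeasure (PathSp T d)) × PathSp T d | evalAt hT q.1.1 q.2 ∈ s} :=
    ((continuous_evalAt_uncurry hT).measurable.comp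
      (measurable_fst.fst.prodMk measurable_snd)) hs
  exact ProbabilityTheory.Kernel.measurable_kernel_prodMk_left
    (κ := ProbabilityTheory.Kernel.prodMkLeft ℝ (coeKernel (PathSp T d))) hset

/-- Triples consisting of a law, a path and a time. -/
abbrev LawPathTime (T : ℝ) (d : ℕ) := (ProbabilityMeasure (PathSp T d) × PathSp T d) × ℝ

theorem measurable_evalAt_lawPathTime :
    Measurable fun p : LawPathTime T d => evalAt hT p.2 p.1.2 :=
  (continuous_evalAt_uncurry hT).measurable.comp (measurable_snd.prodMk measurable_fst.snd)

theorem measurable_coeff_lawPathTime {F : Type*} [MeasurableSpace F]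
    {c : ℝ → Ed d → Measure (Ed d) → F}
    (hc : Measurable fun p : ℝ × Ed d × Measure (Ed d) => c p.1 p.2.1 p.2.2) :
    Measurable fun p : LawPathTime T d =>
      c p.2 (evalAt hT p.2 p.1.2)
        ((p.1.1 : Measure (PathSp T d)).map (evalAt hT p.2)) :=
  hc.comp (measurable_snd.prodMk ((measurable_evalAt_lawPathTime hT).prodMk
    ((measurable_map_evalAt hT).comp (measurable_snd.prodMk measurable_fst.fst))))

variable {b a}
variable (hb : Measurable fun p : ℝ × Ed d × Measure (Ed d) => b p.1 p.2.1 p.2.2)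
  (ha : Measurable fun p : ℝ × Ed d × Measure (Ed d) => a p.1 p.2.1 p.2.2)

include hb ha

theorem measurable_coeffWeight :
    Measurable fun p : LawPathTime T d =>
      coeffWeight hT b a (p.1.1 : Measure (PathSp T d)) p.1.2 p.2 := by
  have he := measurable_evalAt_lawPathTime (d := d) hT
  exact ((measurable_coeff_lawPathTime hT hb).norm.div (he.norm.const_add 1)).add
    ((measurable_coeff_lawPathTime hT ha).norm.div ((he.norm.pow_const 2).const_add 1))

theorem measurable_driftIntegrand {ξ : ℝ → ℝ} {φ : Ed d → ℝ} (hξ : IsTestXi T ξ)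
    (hφ : IsTestPhi φ) :
    Measurable fun p : LawPathTime T d =>
      driftIntegrand hT b a (p.1.1 : Measure (PathSp T d)) ξ φ p.1.2 p.2 := by
  have he := measurable_evalAt_lawPathTime (d := d) hT
  have h1 : Measurable fun p : LawPathTime T d => deriv ξ p.2 * φ (evalAt hT p.2 p.1.2) :=
    ((measurable_deriv ξ).comp measurable_snd).mul (hφ.1.continuous.measurable.comp he)
  have h2 := (measurable_coeff_lawPathTime hT hb).inner (𝕜 := ℝ)
    (hφ.contDiff_gradient.continuous.measurable.comp he)
  have h3 : Measurable fun q : (Ed d →L[ℝ] Ed d) × (Ed d →L[ℝ] Ed d) =>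
      traceCLM d (q.1 ∘L q.2) := by
    have : Continuous fun q : (Ed d →L[ℝ] Ed d) × (Ed d →L[ℝ] Ed d) =>
      traceCLM d (q.1 ∘L q.2) := (traceCLM d).continuous.comp (by fun_prop)
    exact this.measurable
  have h4 := h3.comp ((measurable_coeff_lawPathTime hT ha).prodMk
    (hφ.continuous_fderiv_gradient.measurable.comp he))
  exact h1.add ((hξ.1.continuous.measurable.comp measurable_snd).mul
    (h2.add (h4.const_mul (1 / 2))))

theorem measurable_Xproc {ξ : ℝ → ℝ} {φ : Ed d → ℝ} (hξ : IsTestXi T ξ)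
    (hφ : IsTestPhi φ) {t : ℝ} (ht : 0 ≤ t) :
    Measurable fun p : ProbabilityMeasure (PathSp T d) × PathSp T d =>
      Xproc hT b a (p.1 : Measure (PathSp T d)) ξ φ t p.2 := by
  have h1 := ((measurable_driftIntegrand hT hb ha hξ hφ).stronglyMeasurable.integral_prod_right'
    (ν := volume.restrict (Ioc 0 t))).measurable
  simp only [Xproc, intervalIntegral.integral_of_le ht]
  exact (((hφ.1.continuous.measurable.comp (measurable_evalAt hT t)).comp
    measurable_snd).const_mul (ξ t)).sub h1

theorem measurable_integral_Xproc_sub {ξ : ℝ → ℝ} {φ : Ed d → ℝ} (hξ : IsTestXi T ξ)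
    (hφ : IsTestPhi φ) {s t : ℝ} (hs : 0 ≤ s) (ht : 0 ≤ t) {A : Set (PathSp T d)}
    (hA : MeasurableSet A) :
    Measurable fun lam : ProbabilityMeasure (PathSp T d) =>
      ∫ γ in A, (Xproc hT b a (lam : Measure (PathSp T d)) ξ φ t γ -
        Xproc hT b a (lam : Measure (PathSp T d)) ξ φ s γ) ∂(lam : Measure (PathSp T d)) := by
  simp only [← integral_indicator hA]
  refine (StronglyMeasurable.integral_kernel_prod_right (κ := coeKernel (PathSp T d))
    (f := fun lam => A.indicator fun γ => Xproc hT b a (lam : Measure (PathSp T d)) ξ φ t γ -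
        Xproc hT b a (lam : Measure (PathSp T d)) ξ φ s γ) ?_).measurable
  exact (((measurable_Xproc hT hb ha hξ hφ ht).sub
    (measurable_Xproc hT hb ha hξ hφ hs)).indicator (measurable_snd hA)).stronglyMeasurable

theorem measurable_lintegral_coeffWeight :
    Measurable fun lam : ProbabilityMeasure (PathSp T d) =>
      ∫⁻ γ, ∫⁻ t in Icc (0 : ℝ) T,
        ENNReal.ofReal (coeffWeight hT b a (lam : Measure (PathSp T d)) γ t)
        ∂volume ∂(lam : Measure (PathSp T d)) :=
  Measurable.lintegral_kernel_prod_right (κ := coeKernel (PathSp T d))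
    ((measurable_coeffWeight hT hb ha).ennreal_ofReal.lintegral_prod_right'
      (ν := volume.restrict (Icc 0 T)))

end Measurability

/-- A pair of test functions with weighted `C¹` and `C²` bounds `N`. -/
structure TestBound (T : ℝ) {d : ℕ} (N : ℝ) (ξ : ℝ → ℝ) (φ : Ed d → ℝ) : Prop where
  xi : IsTestXi T ξ
  phi : IsTestPhi φ
  xi_le : ∀ r, |ξ r| ≤ N
  deriv_le : ∀ r, |deriv ξ r| ≤ N
  phi_le : ∀ x, |φ x| ≤ N
  gradient_le : ∀ x, ‖gradient φ x‖ * (1 + ‖x‖) ≤ N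
  hessian_le : ∀ x, ‖fderiv ℝ (gradient φ) x‖ * (1 + ‖x‖ ^ 2) ≤ N

theorem TestBound.nonneg {T : ℝ} {d : ℕ} {N : ℝ} {ξ : ℝ → ℝ} {φ : Ed d → ℝ}
    (h : TestBound T N ξ φ) : 0 ≤ N :=
  (abs_nonneg _).trans (h.xi_le 0)

theorem IsTestPhi.hasCompactSupport_gradient {d : ℕ} {φ : Ed d → ℝ} (hφ : IsTestPhi φ) :
    HasCompactSupport (gradient φ) :=
  (hφ.2.fderiv ℝ).comp_left (g := (InnerProductSpace.toDual ℝ (Ed d)).symm)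
    (map_zero (InnerProductSpace.toDual ℝ (Ed d)).symm)

theorem Continuous.exists_norm_mul_le_of_hasCompactSupport {X F : Type*} [TopologicalSpace X]
    [NormedAddCommGroup F] {f : X → F} {w : X → ℝ} (hf : Continuous f)
    (hs : HasCompactSupport f) (hw : Continuous w) : ∃ C : ℝ, ∀ x, ‖f x‖ * w x ≤ C := by
  obtain ⟨C, hC⟩ := (hf.norm.mul hw).bounded_above_of_compact_support hs.norm.mul_right
  exact ⟨C, fun x => (le_abs_self _).trans (hC x)⟩

theorem exists_testBound {T : ℝ} {d : ℕ} {ξ : ℝ → ℝ} {φ : Ed d → ℝ} (hξ : IsTestXi T ξ)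
    (hφ : IsTestPhi φ) : ∃ N : ℕ, TestBound T N ξ φ := by
  obtain ⟨C1, h1⟩ := hξ.1.continuous.bounded_above_of_compact_support hξ.2.1
  obtain ⟨C2, h2⟩ := (hξ.1.continuous_deriv le_rfl).bounded_above_of_compact_support hξ.2.1.deriv
  obtain ⟨C3, h3⟩ := hφ.1.continuous.bounded_above_of_compact_support hφ.2
  obtain ⟨C4, h4⟩ := hφ.contDiff_gradient.continuous.exists_norm_mul_le_of_hasCompactSupport
    (w := fun x => 1 + ‖x‖) hφ.hasCompactSupport_gradient (by fun_prop)
  obtain ⟨C5, h5⟩ := hφ.continuous_fderiv_gradient.exists_norm_mul_le_of_hasCompactSupport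
    (w := fun x => 1 + ‖x‖ ^ 2) (hφ.hasCompactSupport_gradient.fderiv ℝ) (by fun_prop)
  obtain ⟨N, hN⟩ := exists_nat_ge (max C1 (max C2 (max C3 (max C4 C5))))
  simp only [max_le_iff] at hN
  exact ⟨N, hξ, hφ, fun r => (h1 r).trans hN.1, fun r => (h2 r).trans hN.2.1,
    fun x => (h3 x).trans hN.2.2.1, fun x => (h4 x).trans hN.2.2.2.1,
    fun x => (h5 x).trans hN.2.2.2.2⟩

/-- Pointwise convergence of pairs of test functions together with their derivatives. -/
structure TestTendsto {d : ℕ} (ξn : ℕ → ℝ → ℝ) (φn : ℕ → Ed d → ℝ) (ξ : ℝ → ℝ)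
    (φ : Ed d → ℝ) : Prop where
  xi : ∀ r, Tendsto (fun n => ξn n r) atTop (𝓝 (ξ r))
  deriv : ∀ r, Tendsto (fun n => deriv (ξn n) r) atTop (𝓝 (deriv ξ r))
  phi : ∀ x, Tendsto (fun n => φn n x) atTop (𝓝 (φ x))
  gradient : ∀ x, Tendsto (fun n => gradient (φn n) x) atTop (𝓝 (gradient φ x))
  hessian : ∀ x, Tendsto (fun n => fderiv ℝ (_root_.gradient (φn n)) x) atTop
    (𝓝 (fderiv ℝ (_root_.gradient φ) x))

theorem exists_countable_testBound (T : ℝ) (d : ℕ) (N : ℝ) :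
    ∃ D : Set ((ℝ → ℝ) × (Ed d → ℝ)), D.Countable ∧ (∀ p ∈ D, TestBound T N p.1 p.2) ∧
      ∀ ξ φ, TestBound T N ξ φ → ∃ u : ℕ → (ℝ → ℝ) × (Ed d → ℝ), (∀ n, u n ∈ D) ∧
        TestTendsto (fun n => (u n).1) (fun n => (u n).2) ξ φ := by
  let ι := {p : (ℝ → ℝ) × (Ed d → ℝ) // TestBound T N p.1 p.2}
  let J : ι → C(ℝ, ℝ × ℝ) × C(Ed d, ℝ × Ed d × (Ed d →L[ℝ] Ed d)) := fun p =>
    (⟨fun r => (p.1.1 r, deriv p.1.1 r),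
      p.2.xi.1.continuous.prodMk (p.2.xi.1.continuous_deriv le_rfl)⟩,
     ⟨fun x => (p.1.2 x, gradient p.1.2 x, fderiv ℝ (gradient p.1.2) x),
      p.2.phi.1.continuous.prodMk
        (p.2.phi.contDiff_gradient.continuous.prodMk p.2.phi.continuous_fderiv_gradient)⟩)
  obtain ⟨D, hDc, hD⟩ := exists_countable_seq_tendsto J
  refine ⟨Subtype.val '' D, hDc.image _, ?_, fun ξ φ h => ?_⟩
  · rintro _ ⟨p, -, rfl⟩
    exact p.2
  obtain ⟨u, hu, hlim⟩ := hD ⟨(ξ, φ), h⟩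
  have h1 : ∀ r, Tendsto (fun n => (J (u n)).1 r) atTop (𝓝 (ξ r, deriv ξ r)) := fun r =>
    ((ContinuousEvalConst.continuous_eval_const r).tendsto _).comp hlim.fst_nhds
  have h2 : ∀ x, Tendsto (fun n => (J (u n)).2 x) atTop
      (𝓝 (φ x, gradient φ x, fderiv ℝ (gradient φ) x)) := fun x =>
    ((ContinuousEvalConst.continuous_eval_const x).tendsto _).comp hlim.snd_nhds
  exact ⟨fun n => (u n).1, fun n => mem_image_of_mem _ (hu n), fun r => (h1 r).fst_nhds,
    fun r => (h1 r).snd_nhds, fun x => (h2 x).fst_nhds, fun x => (h2 x).snd_nhds.fst_nhds,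
    fun x => (h2 x).snd_nhds.snd_nhds⟩

theorem MeasureTheory.integral_mul_eq_zero_of_tendsto {Ω : Type*} [MeasurableSpace Ω]
    {μ : Measure Ω} {Yn : ℕ → Ω → ℝ} {Y G H : Ω → ℝ} (hG : Integrable G μ)
    (hYn : ∀ n, Measurable (Yn n)) (hbound : ∀ n, ∀ᵐ ω ∂μ, |Yn n ω| ≤ G ω)
    (hlim : ∀ᵐ ω ∂μ, Tendsto (fun n => Yn n ω) atTop (𝓝 (Y ω))) (hH : Measurable H)
    (hH01 : ∀ ω, H ω ∈ Icc (0 : ℝ) 1) (hzero : ∀ n, ∫ ω, H ω * Yn n ω ∂μ = 0) :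
    ∫ ω, H ω * Y ω ∂μ = 0 := by
  have h : Tendsto (fun n => ∫ ω, H ω * Yn n ω ∂μ) atTop (𝓝 (∫ ω, H ω * Y ω ∂μ)) := by
    refine tendsto_integral_of_dominated_convergence G
      (fun n => (hH.mul (hYn n)).aestronglyMeasurable) hG (fun n => ?_) ?_
    · filter_upwards [hbound n] with ω hω
      rw [norm_mul, Real.norm_of_nonneg (hH01 ω).1, Real.norm_eq_abs]
      exact (mul_le_of_le_one_left (abs_nonneg _) (hH01 ω).2).trans hω
    · filter_upwards [hlim] with ω hω using hω.const_mul _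
  simp only [hzero] at h
  exact tendsto_nhds_unique h tendsto_const_nhds

theorem exists_seq_rat_tendsto {x y z : ℝ} (hxy : x < y) (hz : z ∈ Icc x y) :
    ∃ q : ℕ → ℚ, (∀ n, (q n : ℝ) ∈ Ioo x y) ∧ Tendsto (fun n => (q n : ℝ)) atTop (𝓝 z) := by
  have h1 : z ∈ closure (Ioo x y ∩ range ((↑) : ℚ → ℝ)) := by
    refine closure_minimal (Rat.denseRange_cast.open_subset_closure_inter isOpen_Ioo)
      isClosed_closure ?_
    rwa [closure_Ioo hxy.ne]
  obtain ⟨u, hu, hlim⟩ := mem_closure_iff_seq_limit.1 h1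
  choose q hq using fun n => (hu n).2
  exact ⟨q, fun n => by rw [hq]; exact (hu n).1, by simpa only [hq] using hlim⟩

section Paths

variable {d : ℕ} {T : ℝ} (hT : 0 ≤ T) {b : ℝ → Ed d → Measure (Ed d) → Ed d}
  {a : ℝ → Ed d → Measure (Ed d) → (Ed d →L[ℝ] Ed d)} {N : ℝ}

theorem coeffWeight_nonneg (lam : Measure (PathSp T d)) (γ : PathSp T d) (t : ℝ) :
    0 ≤ coeffWeight hT b a lam γ t := by
  unfold coeffWeight; positivity

/-- The dominating function for `driftIntegrand` on test functions of size `N`. -/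
def driftBound (N : ℝ) (b : ℝ → Ed d → Measure (Ed d) → Ed d)
    (a : ℝ → Ed d → Measure (Ed d) → (Ed d →L[ℝ] Ed d)) (lam : Measure (PathSp T d))
    (γ : PathSp T d) (r : ℝ) : ℝ :=
  N ^ 2 * (1 + (1 + ‖traceCLM d‖) * coeffWeight hT b a lam γ r)

theorem driftBound_nonneg (lam : Measure (PathSp T d)) (γ : PathSp T d) (r : ℝ) :
    0 ≤ driftBound hT N b a lam γ r := by
  have := coeffWeight_nonneg hT (b := b) (a := a) lam γ r
  unfold driftBound; positivity

theorem TestBound.abs_driftIntegrand_le {ξ : ℝ → ℝ} {φ : Ed d → ℝ} (h : TestBound T N ξ φ)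
    (lam : Measure (PathSp T d)) (γ : PathSp T d) (r : ℝ) :
    |driftIntegrand hT b a lam ξ φ γ r| ≤ driftBound hT N b a lam γ r := by
  have hN := h.nonneg
  unfold driftIntegrand driftBound coeffWeight Lop
  rw [← traceCLM_apply]
  set x := evalAt hT r γ
  set B := b r x (lam.map (evalAt hT r))
  set A := a r x (lam.map (evalAt hT r))
  have h1 : |⟪B, gradient φ x⟫| ≤ N * (‖B‖ / (1 + ‖x‖)) := by
    calc |⟪B, gradient φ x⟫| ≤ ‖B‖ * ‖gradient φ x‖ := abs_real_inner_le_norm _ _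
      _ = (‖gradient φ x‖ * (1 + ‖x‖)) * (‖B‖ / (1 + ‖x‖)) := by field_simp
      _ ≤ N * (‖B‖ / (1 + ‖x‖)) := by gcongr; exact h.gradient_le x
  have h2 : |traceCLM d (A ∘L fderiv ℝ (gradient φ) x)| ≤
      ‖traceCLM d‖ * (N * (‖A‖ / (1 + ‖x‖ ^ 2))) := by
    calc |traceCLM d (A ∘L fderiv ℝ (gradient φ) x)|
        ≤ ‖traceCLM d‖ * ‖A ∘L fderiv ℝ (gradient φ) x‖ := (traceCLM d).le_opNorm _
      _ ≤ ‖traceCLM d‖ * (‖A‖ * ‖fderiv ℝ (gradient φ) x‖) := by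
        gcongr; exact ContinuousLinearMap.opNorm_comp_le _ _
      _ = ‖traceCLM d‖ *
          ((‖fderiv ℝ (gradient φ) x‖ * (1 + ‖x‖ ^ 2)) * (‖A‖ / (1 + ‖x‖ ^ 2))) := by
        field_simp
      _ ≤ _ := by gcongr; exact h.hessian_le x
  set β := ‖B‖ / (1 + ‖x‖)
  set α := ‖A‖ / (1 + ‖x‖ ^ 2)
  have hβ : 0 ≤ β := by positivity
  have hα : 0 ≤ α := by positivity
  have hτ : 0 ≤ ‖traceCLM d‖ := norm_nonneg (traceCLM d)
  set τ := ‖traceCLM d‖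
  have h3 : |⟪B, gradient φ x⟫ + 1 / 2 * traceCLM d (A ∘L fderiv ℝ (gradient φ) x)| ≤
      N * ((1 + τ) * (β + α)) := by
    refine (abs_add_le _ _).trans ?_
    rw [abs_mul, abs_of_nonneg (by norm_num : (0 : ℝ) ≤ 1 / 2)]
    have : 0 ≤ N * (τ * β) := by positivity
    have : 0 ≤ N * α := by positivity
    have : 0 ≤ N * (τ * α) := by positivity
    nlinarith
  calc _ ≤ |deriv ξ r| * |φ x| + |ξ r| *
        |⟪B, gradient φ x⟫ + 1 / 2 * traceCLM d (A ∘L fderiv ℝ (gradient φ) x)| := by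
        rw [← abs_mul, ← abs_mul]; exact abs_add_le _ _
    _ ≤ N * N + N * (N * ((1 + τ) * (β + α))) := by
        gcongr
        · exact h.deriv_le r
        · exact h.phi_le x
        · exact h.xi_le r
    _ = _ := by ring

theorem TestTendsto.tendsto_driftIntegrand {ξn : ℕ → ℝ → ℝ} {φn : ℕ → Ed d → ℝ} {ξ : ℝ → ℝ}
    {φ : Ed d → ℝ} (h : TestTendsto ξn φn ξ φ) (lam : Measure (PathSp T d)) (γ : PathSp T d)
    (r : ℝ) :
    Tendsto (fun n => driftIntegrand hT b a lam (ξn n) (φn n) γ r) atTop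
      (𝓝 (driftIntegrand hT b a lam ξ φ γ r)) := by
  refine ((h.deriv r).mul (h.phi _)).add ((h.xi r).mul ((tendsto_const_nhds.inner
    (h.gradient _)).add (Tendsto.const_mul _ ?_)))
  have : Continuous fun B : Ed d →L[ℝ] Ed d =>
      traceCLM d (a r (evalAt hT r γ) (lam.map (evalAt hT r)) ∘L B) :=
    (traceCLM d).continuous.comp (by fun_prop)
  exact (this.tendsto _).comp (h.hessian (evalAt hT r γ))

variable (hb : Measurable fun p : ℝ × Ed d × Measure (Ed d) => b p.1 p.2.1 p.2.2)
  (ha : Measurable fun p : ℝ × Ed d × Measure (Ed d) => a p.1 p.2.1 p.2.2)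
  {lam : ProbabilityMeasure (PathSp T d)}

include hb ha

theorem TestBound.integrableOn_driftIntegrand {ξ : ℝ → ℝ} {φ : Ed d → ℝ}
    (h : TestBound T N ξ φ) {γ : PathSp T d}
    (hγ : IntegrableOn (driftBound hT N b a (lam : Measure (PathSp T d)) γ) (Icc 0 T)) :
    IntegrableOn (driftIntegrand hT b a (lam : Measure (PathSp T d)) ξ φ γ) (Icc 0 T) :=
  Integrable.mono' hγ
    ((measurable_driftIntegrand hT hb ha h.xi h.phi).comp
      (measurable_prodMk_left (x := (lam, γ)))).aestronglyMeasurable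
    (ae_of_all _ fun r => h.abs_driftIntegrand_le hT _ γ r)

omit hb ha in
theorem TestBound.abs_Xproc_le {ξ : ℝ → ℝ} {φ : Ed d → ℝ} (h : TestBound T N ξ φ)
    {γ : PathSp T d}
    (hγ : IntegrableOn (driftBound hT N b a (lam : Measure (PathSp T d)) γ) (Icc 0 T))
    {t : ℝ} (ht : t ∈ Icc 0 T) :
    |Xproc hT b a (lam : Measure (PathSp T d)) ξ φ t γ| ≤
      N ^ 2 + ∫ r in Icc 0 T, driftBound hT N b a (lam : Measure (PathSp T d)) γ r := by
  have hN := h.nonneg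
  have hsub : Ioc 0 t ⊆ Icc 0 T := Ioc_subset_Icc_self.trans (Icc_subset_Icc_right ht.2)
  refine (abs_sub _ _).trans (add_le_add ?_ ?_)
  · rw [abs_mul, sq]
    gcongr
    · exact h.xi_le t
    · exact h.phi_le _
  · rw [intervalIntegral.integral_of_le ht.1]
    refine (norm_integral_le_of_norm_le
      (f := driftIntegrand hT b a (lam : Measure (PathSp T d)) ξ φ γ) (hγ.mono_set hsub)
      (ae_of_all _ fun r => h.abs_driftIntegrand_le hT _ γ r)).trans ?_
    exact setIntegral_mono_set hγ (ae_of_all _ fun r => driftBound_nonneg hT _ γ r)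
      hsub.eventuallyLE

theorem TestBound.continuousOn_Xproc {ξ : ℝ → ℝ} {φ : Ed d → ℝ} (h : TestBound T N ξ φ)
    {γ : PathSp T d}
    (hγ : IntegrableOn (driftBound hT N b a (lam : Measure (PathSp T d)) γ) (Icc 0 T)) :
    ContinuousOn (fun t => Xproc hT b a (lam : Measure (PathSp T d)) ξ φ t γ) (Icc 0 T) := by
  refine (h.xi.1.continuous.mul
    (h.phi.1.continuous.comp (continuous_evalAt_left hT γ))).continuousOn.sub ?_
  have := intervalIntegral.continuousOn_primitive_interval (μ := volume) (a := 0) (b := T)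
    (f := driftIntegrand hT b a (lam : Measure (PathSp T d)) ξ φ γ)
  rw [uIcc_of_le hT] at this
  exact this (h.integrableOn_driftIntegrand hT hb ha hγ)

theorem TestTendsto.tendsto_Xproc {ξn : ℕ → ℝ → ℝ} {φn : ℕ → Ed d → ℝ} {ξ : ℝ → ℝ}
    {φ : Ed d → ℝ} (h : TestTendsto ξn φn ξ φ) (hn : ∀ n, TestBound T N (ξn n) (φn n))
    {γ : PathSp T d}
    (hγ : IntegrableOn (driftBound hT N b a (lam : Measure (PathSp T d)) γ) (Icc 0 T))
    {t : ℝ} (ht : t ∈ Icc 0 T) :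
    Tendsto (fun n => Xproc hT b a (lam : Measure (PathSp T d)) (ξn n) (φn n) t γ) atTop
      (𝓝 (Xproc hT b a (lam : Measure (PathSp T d)) ξ φ t γ)) := by
  have hsub : Ioc 0 t ⊆ Icc 0 T := Ioc_subset_Icc_self.trans (Icc_subset_Icc_right ht.2)
  refine ((h.xi t).mul (h.phi _)).sub ?_
  simp only [intervalIntegral.integral_of_le ht.1]
  refine tendsto_integral_of_dominated_convergence
    (F := fun n => driftIntegrand hT b a (lam : Measure (PathSp T d)) (ξn n) (φn n) γ)
    (f := driftIntegrand hT b a (lam : Measure (PathSp T d)) ξ φ γ)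
    (driftBound hT N b a (lam : Measure (PathSp T d)) γ)
    (fun n => (((hn n).integrableOn_driftIntegrand hT hb ha hγ).mono_set
      hsub).aestronglyMeasurable) (hγ.mono_set hsub)
    (fun n => ae_of_all _ fun r => (hn n).abs_driftIntegrand_le hT _ γ r)
    (ae_of_all _ fun r => h.tendsto_driftIntegrand hT _ γ r)

theorem measurable_uncurry_coeffWeight (lam : ProbabilityMeasure (PathSp T d)) :
    Measurable (uncurry (coeffWeight hT b a (lam : Measure (PathSp T d)))) := by
  have hι : Measurable fun q : PathSp T d × ℝ => (((lam, q.1), q.2) : LawPathTime T d) := by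
    fun_prop
  have h := (measurable_coeffWeight hT hb ha).comp hι
  simpa only [comp_def, uncurry_def] using h

theorem integrable_coeffWeight
    (hfin : ∫⁻ γ, ∫⁻ t in Icc (0 : ℝ) T,
      ENNReal.ofReal (coeffWeight hT b a (lam : Measure (PathSp T d)) γ t)
      ∂volume ∂(lam : Measure (PathSp T d)) < ∞) :
    Integrable (uncurry (coeffWeight hT b a (lam : Measure (PathSp T d))))
      ((lam : Measure (PathSp T d)).prod (volume.restrict (Icc 0 T))) := by
  have hm := measurable_uncurry_coeffWeight hT hb ha lam
  have h0 : 0 ≤ᵐ[(lam : Measure (PathSp T d)).prod (volume.restrict (Icc 0 T))]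
      uncurry (coeffWeight hT b a (lam : Measure (PathSp T d))) :=
    ae_of_all _ fun p => coeffWeight_nonneg hT _ p.1 p.2
  have h1 := lintegral_prod (μ := (lam : Measure (PathSp T d))) (ν := volume.restrict (Icc 0 T))
    _ hm.ennreal_ofReal.aemeasurable
  have h2 := (hasFiniteIntegral_iff_ofReal h0).2 (h1.trans_lt hfin)
  exact ⟨hm.aestronglyMeasurable, h2⟩

theorem integrable_driftBound (N : ℝ)
    (hfin : ∫⁻ γ, ∫⁻ t in Icc (0 : ℝ) T,
      ENNReal.ofReal (coeffWeight hT b a (lam : Measure (PathSp T d)) γ t)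
      ∂volume ∂(lam : Measure (PathSp T d)) < ∞) :
    Integrable (uncurry (driftBound hT N b a (lam : Measure (PathSp T d))))
      ((lam : Measure (PathSp T d)).prod (volume.restrict (Icc 0 T))) :=
  ((integrable_const (1 : ℝ)).add
    ((integrable_coeffWeight hT hb ha hfin).const_mul _)).const_mul _

end Paths

section Characterization

variable {d : ℕ} {T : ℝ} (hT : 0 ≤ T) {b : ℝ → Ed d → Measure (Ed d) → Ed d}
  {a : ℝ → Ed d → Measure (Ed d) → (Ed d →L[ℝ] Ed d)}
  (hb : Measurable fun p : ℝ × Ed d × Measure (Ed d) => b p.1 p.2.1 p.2.2)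
  (ha : Measurable fun p : ℝ × Ed d × Measure (Ed d) => a p.1 p.2.1 p.2.2)
  {lam : ProbabilityMeasure (PathSp T d)}

include hb ha

theorem measurable_Xproc_right (lam : ProbabilityMeasure (PathSp T d)) {ξ : ℝ → ℝ} {φ : Ed d → ℝ}
    (hξ : IsTestXi T ξ) (hφ : IsTestPhi φ) {t : ℝ} (ht : 0 ≤ t) :
    Measurable (Xproc hT b a (lam : Measure (PathSp T d)) ξ φ t) :=
  (measurable_Xproc hT hb ha hξ hφ ht).comp (measurable_prodMk_left (x := lam))

/-- The martingale condition is determined by a countable family of test functions, rational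
times, and countable algebras generating the natural filtration. -/
theorem forall_martCond_iff {D : ℕ → Set ((ℝ → ℝ) × (Ed d → ℝ))}
    (hD : ∀ N : ℕ, ∀ p ∈ D N, TestBound T N p.1 p.2)
    (hDdense : ∀ N : ℕ, ∀ ξ φ, TestBound T N ξ φ → ∃ u : ℕ → (ℝ → ℝ) × (Ed d → ℝ),
      (∀ n, u n ∈ D N) ∧ TestTendsto (fun n => (u n).1) (fun n => (u n).2) ξ φ)
    {C : ℝ → Set (Set (PathSp T d))} (hC : ∀ s, 0 ≤ s → IsSetAlgebra (C s))
    (hCgen : ∀ s, 0 ≤ s → natFilt T d s = MeasurableSpace.generateFrom (C s))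
    (hfin : ∫⁻ γ, ∫⁻ t in Icc (0 : ℝ) T,
      ENNReal.ofReal (coeffWeight hT b a (lam : Measure (PathSp T d)) γ t)
      ∂volume ∂(lam : Measure (PathSp T d)) < ∞) :
    (∀ ξ φ, IsTestXi T ξ → IsTestPhi φ →
      MartCond (lam : Measure (PathSp T d)) (Xproc hT b a (lam : Measure (PathSp T d)) ξ φ)) ↔
    ∀ N : ℕ, ∀ p ∈ D N, ∀ s t : ℚ, (0 : ℝ) ≤ s → (s : ℝ) ≤ t → (t : ℝ) ≤ T → ∀ A ∈ C s,
      ∫ γ in A, (Xproc hT b a (lam : Measure (PathSp T d)) p.1 p.2 t γ -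
        Xproc hT b a (lam : Measure (PathSp T d)) p.1 p.2 s γ)
          ∂(lam : Measure (PathSp T d)) = 0 := by
  constructor
  · intro h N p hp s t hs hst ht A hA
    have hAm : MeasurableSet[natFilt T d s] A := by
      rw [hCgen s hs]; exact MeasurableSpace.measurableSet_generateFrom hA
    have := h p.1 p.2 (hD N p hp).xi (hD N p hp).phi s t hs hst ht _
      (MeasurableSet.measurable_indicator_one hAm) (fun γ => by
        by_cases hγ : γ ∈ A <;> simp [hγ])
    rw [← integral_indicator (natFilt_le T d s A hAm), ← this]
    refine integral_congr_ae (ae_of_all _ fun γ => ?_)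
    by_cases hγ : γ ∈ A <;> simp [hγ]
  intro h ξ φ hξ hφ
  obtain ⟨N, hN⟩ := exists_testBound hξ hφ
  have hint := integrable_driftBound hT hb ha N hfin
  set w := driftBound hT N b a (lam : Measure (PathSp T d))
  have hgood : ∀ᵐ γ ∂(lam : Measure (PathSp T d)), IntegrableOn (w γ) (Icc 0 T) :=
    hint.prod_right_ae
  let G : PathSp T d → ℝ := fun γ =>
    ((N : ℝ) ^ 2 + ∫ r in Icc 0 T, w γ r) + ((N : ℝ) ^ 2 + ∫ r in Icc 0 T, w γ r)
  have hG : Integrable G (lam : Measure (PathSp T d)) :=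
    have h1 : Integrable (fun γ => (N : ℝ) ^ 2 + ∫ r in Icc 0 T, w γ r)
        (lam : Measure (PathSp T d)) := (integrable_const _).add hint.integral_prod_left
    h1.add h1
  have hYG : ∀ {ξ φ}, TestBound T N ξ φ → ∀ {s t : ℝ}, s ∈ Icc 0 T → t ∈ Icc 0 T →
      ∀ᵐ γ ∂(lam : Measure (PathSp T d)),
        |Xproc hT b a (lam : Measure (PathSp T d)) ξ φ t γ -
          Xproc hT b a (lam : Measure (PathSp T d)) ξ φ s γ| ≤ G γ := by
    intro ξ φ hb' s t hs ht
    filter_upwards [hgood] with γ hγ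
    exact (abs_sub _ _).trans (add_le_add (hb'.abs_Xproc_le hT hγ ht) (hb'.abs_Xproc_le hT hγ hs))
  have hYm : ∀ {ξ φ}, TestBound T N ξ φ → ∀ {s t : ℝ}, 0 ≤ s → 0 ≤ t →
      Measurable fun γ => Xproc hT b a (lam : Measure (PathSp T d)) ξ φ t γ -
          Xproc hT b a (lam : Measure (PathSp T d)) ξ φ s γ := fun hb' _ _ hs ht =>
    (measurable_Xproc_right hT hb ha lam hb'.xi hb'.phi ht).sub
      (measurable_Xproc_right hT hb ha lam hb'.xi hb'.phi hs)
  have hrat : ∀ s t : ℚ, (0 : ℝ) ≤ s → (s : ℝ) ≤ t → (t : ℝ) ≤ T → ∀ H : PathSp T d → ℝ,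
      Measurable[natFilt T d s] H → (∀ γ, H γ ∈ Icc (0 : ℝ) 1) →
      ∫ γ, H γ * (Xproc hT b a (lam : Measure (PathSp T d)) ξ φ t γ -
        Xproc hT b a (lam : Measure (PathSp T d)) ξ φ s γ) ∂(lam : Measure (PathSp T d)) = 0 := by
    intro s t hs hst ht H hH hH01
    obtain ⟨u, hu, hlim⟩ := hDdense N ξ φ hN
    have hsT : (s : ℝ) ∈ Icc 0 T := ⟨hs, hst.trans ht⟩
    have htT : (t : ℝ) ∈ Icc 0 T := ⟨hs.trans hst, ht⟩
    have hub : ∀ n, TestBound T N (u n).1 (u n).2 := fun n => hD N _ (hu n)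
    refine integral_mul_eq_zero_of_tendsto (Yn := fun n γ =>
      Xproc hT b a (lam : Measure (PathSp T d)) (u n).1 (u n).2 t γ -
        Xproc hT b a (lam : Measure (PathSp T d)) (u n).1 (u n).2 s γ) hG
      (fun n => hYm (hub n) hsT.1 htT.1) (fun n => hYG (hub n) hsT htT) ?_
      (hH.mono (natFilt_le T d s) le_rfl) hH01 fun n => ?_
    · filter_upwards [hgood] with γ hγ
      exact (hlim.tendsto_Xproc hT hb ha hub hγ htT).sub
        (hlim.tendsto_Xproc hT hb ha hub hγ hsT)
    · exact integral_mul_eq_zero_of_isSetAlgebra (natFilt_le T d s) (hC s hs) (hCgen s hs)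
        (hG.mono' (hYm (hub n) hsT.1 htT.1).aestronglyMeasurable (hYG (hub n) hsT htT))
        (h N _ (hu n) s t hs hst ht) hH hH01
  intro s t hs hst ht H hH hH01
  rcases hst.eq_or_lt with rfl | hlt
  · simp
  obtain ⟨m, hsm, hmt⟩ := exists_between hlt
  obtain ⟨p, hp, hplim⟩ := exists_seq_rat_tendsto hsm (left_mem_Icc.2 hsm.le)
  obtain ⟨q, hq, hqlim⟩ := exists_seq_rat_tendsto hmt (right_mem_Icc.2 hmt.le)
  have hpT : ∀ n, (p n : ℝ) ∈ Icc 0 T := fun n =>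
    ⟨hs.trans (hp n).1.le, (hp n).2.le.trans (hmt.le.trans ht)⟩
  have hqT : ∀ n, (q n : ℝ) ∈ Icc 0 T := fun n =>
    ⟨(hs.trans hsm.le).trans (hq n).1.le, (hq n).2.le.trans ht⟩
  refine integral_mul_eq_zero_of_tendsto (Yn := fun n γ =>
    Xproc hT b a (lam : Measure (PathSp T d)) ξ φ (q n) γ -
      Xproc hT b a (lam : Measure (PathSp T d)) ξ φ (p n) γ) hG
    (fun n => hYm hN (hpT n).1 (hqT n).1) (fun n => hYG hN (hpT n) (hqT n)) ?_
    (hH.mono (natFilt_le T d s) le_rfl) hH01 fun n => ?_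
  · filter_upwards [hgood] with γ hγ
    have hc := hN.continuousOn_Xproc hT hb ha hγ
    refine Tendsto.sub ?_ ?_
    · exact (hc t ⟨hs.trans hst, ht⟩).tendsto.comp
        (tendsto_nhdsWithin_iff.2 ⟨hqlim, Eventually.of_forall hqT⟩)
    · exact (hc s ⟨hs, hst.trans ht⟩).tendsto.comp
        (tendsto_nhdsWithin_iff.2 ⟨hplim, Eventually.of_forall hpT⟩)
  · exact hrat (p n) (q n) (hpT n).1 ((hp n).2.le.trans (hq n).1.le) (hqT n).2 H
      (hH.mono (natFilt_mono T d (hp n).1.le) le_rfl) hH01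

end Characterization

/-- For Borel coefficients `b, a`, the set `MP(b,a)` of martingale
solutions with the weighted integrability is a Borel subset of `P(C([0,T],ℝ^d))` with
the narrow topology. -/
theorem stmt14 {d : ℕ} {T : ℝ} (hT : 0 ≤ T)
    (b : ℝ → Ed d → Measure (Ed d) → Ed d)
    (a : ℝ → Ed d → Measure (Ed d) → (Ed d →L[ℝ] Ed d))
    (hb : Measurable fun p : ℝ × Ed d × Measure (Ed d) => b p.1 p.2.1 p.2.2)
    (ha : Measurable fun p : ℝ × Ed d × Measure (Ed d) => a p.1 p.2.1 p.2.2) :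
    MeasurableSet[borel (ProbabilityMeasure (PathSp T d))]
      {lam : ProbabilityMeasure (PathSp T d) |
        MPmem hT b a (lam : Measure (PathSp T d))} := by

  refine ProbabilityMeasure.measurableSpace_le_borel _ ?_
  choose D hDc hD hDdense using fun N : ℕ => exists_countable_testBound T d N
  have hCex : ∀ s : ℝ, ∃ C : Set (Set (PathSp T d)), C.Countable ∧
      (0 ≤ s → IsSetAlgebra C ∧ natFilt T d s = MeasurableSpace.generateFrom C) := by
    intro s
    by_cases hs : 0 ≤ s
    · have := countablyGenerated_natFilt hT d hs
      obtain ⟨C, h1, h2⟩ :=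
        MeasurableSpace.exists_countable_isSetAlgebra_generateFrom_eq (natFilt T d s)
      exact ⟨C, h1, fun _ => h2⟩
    · exact ⟨∅, countable_empty, fun h => absurd h hs⟩
  choose C hCc hC using hCex
  have hset : {lam : ProbabilityMeasure (PathSp T d) | MPmem hT b a (lam : Measure (PathSp T d))} =
      {lam : ProbabilityMeasure (PathSp T d) | ∫⁻ γ, ∫⁻ t in Icc (0 : ℝ) T,
        ENNReal.ofReal (coeffWeight hT b a (lam : Measure (PathSp T d)) γ t)
        ∂volume ∂(lam : Measure (PathSp T d)) < ∞} ∩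
      ⋂ N : ℕ, ⋂ p ∈ D N, ⋂ s : ℚ, ⋂ t : ℚ, ⋂ (_ : (0 : ℝ) ≤ s), ⋂ (_ : (s : ℝ) ≤ t),
        ⋂ (_ : (t : ℝ) ≤ T), ⋂ A ∈ C s, {lam : ProbabilityMeasure (PathSp T d) |
        ∫ γ in A, (Xproc hT b a (lam : Measure (PathSp T d)) p.1 p.2 t γ -
          Xproc hT b a (lam : Measure (PathSp T d)) p.1 p.2 s γ)
            ∂(lam : Measure (PathSp T d)) = 0} := by
    ext lam
    simp only [mem_inter_iff, mem_iInter, mem_ofPred_eq]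
    constructor
    · rintro ⟨-, hfin, h⟩
      exact ⟨hfin, (forall_martCond_iff hT hb ha hD hDdense (fun s hs => (hC s hs).1)
        (fun s hs => (hC s hs).2) hfin).1 h⟩
    · rintro ⟨hfin, h⟩
      exact ⟨inferInstance, hfin, (forall_martCond_iff hT hb ha hD hDdense
        (fun s hs => (hC s hs).1) (fun s hs => (hC s hs).2) hfin).2 h⟩
  rw [hset]
  refine (measurableSet_lt (measurable_lintegral_coeffWeight hT hb ha) measurable_const).inter ?_
  refine .iInter fun N => .biInter (hDc N) fun p hp => .iInter fun s => .iInter fun t =>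
    .iInter fun hs => .iInter fun hst => .iInter fun ht => .biInter (hCc s) fun A hA => ?_
  have hAm : MeasurableSet A := natFilt_le T d s A <| by
    rw [(hC s hs).2]; exact MeasurableSpace.measurableSet_generateFrom hA
  exact measurable_integral_Xproc_sub hT hb ha (hD N p hp).xi (hD N p hp).phi hs (hs.trans hst)
    hAm (measurableSet_singleton 0)
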